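/- arXiv:2406.01539 — 2 statements merged into one kernel-verified Lean document; each statement's English description precedes it below -/
import Mathlib

section
/- For all ν, μ ∈ ℤ^d \ {0}, the Gram matrix entry admits the explicit formula G_{νμ} = r_ν r_μ · [ 16π⁴ Σ_{τ,τ'∈T∪{0}} (τ·ν + ‖ν‖₂²)(τ'·μ + ‖μ‖₂²) a_τ \overline{a_{τ'}} δ_{τ+ν, τ'+μ} + ρ² δ_{ν,μ} + 4π²ρ Σ_{τ∈T∪{0}} (τ·ν + ‖ν‖₂²) a_τ δ_{τ+ν, μ} + 4π²ρ Σ_{τ'∈T∪{0}} (τ'·μ + ‖μ‖₂²) \overline{a_{τ'}} δ_{ν, τ'+μ} ], where δ denotes the Kronecker delta and a_0 := a₀. Moreover, G_{00} = r_0² ρ² and G_{ν0} = G_{0ν} = 0 for every ν ∈ ℤ^d \ {0}. -/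
open Finset MeasureTheory

noncomputable def fourF (d : ℕ) (ν : Fin d → ℤ) (x : Fin d → ℝ) : ℂ :=
  Complex.exp (2 * (Real.pi : ℂ) * Complex.I * ∑ j, (ν j : ℂ) * (x j : ℂ))

noncomputable def pdv (d : ℕ) (k : Fin d) (f : (Fin d → ℝ) → ℂ) : (Fin d → ℝ) → ℂ :=
  fun x => fderiv ℝ f x (Pi.single k 1)

noncomputable def lapl (d : ℕ) (f : (Fin d → ℝ) → ℂ) : (Fin d → ℝ) → ℂ :=
  fun x => ∑ k, pdv d k (pdv d k f) x

noncomputable def sqL2 (d : ℕ) (f : (Fin d → ℝ) → ℂ) : ℝ :=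
  ∫ x in Set.Icc (0 : Fin d → ℝ) 1, ‖f x‖ ^ 2

noncomputable def sqH2 (d : ℕ) (f : (Fin d → ℝ) → ℂ) : ℝ :=
  sqL2 d f + (∑ k : Fin d, sqL2 d (pdv d k f)) +
    ∑ k : Fin d, ∑ l : Fin d, sqL2 d (pdv d k (pdv d l f))

noncomputable def enorm2Z (d : ℕ) (ν : Fin d → ℤ) : ℝ := ∑ j, ((ν j : ℝ)) ^ 2

noncomputable def dotZR (d : ℕ) (τ ν : Fin d → ℤ) : ℝ := ∑ j, (τ j : ℝ) * (ν j : ℝ)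

noncomputable def Lop (d : ℕ) (a : (Fin d → ℝ) → ℂ) (ρ : ℝ) (u : (Fin d → ℝ) → ℂ) :
    (Fin d → ℝ) → ℂ :=
  fun x => -(∑ k, pdv d k (fun y => a y * pdv d k u y) x) + (ρ : ℂ) * u x

noncomputable def GramM (d : ℕ) (a : (Fin d → ℝ) → ℂ) (ρ : ℝ)
    (Ψ : (Fin d → ℤ) → (Fin d → ℝ) → ℂ) (ν μ : Fin d → ℤ) : ℂ :=
  ∫ x in Set.Icc (0 : Fin d → ℝ) 1,
    Lop d a ρ (Ψ ν) x * (starRingEnd ℂ) (Lop d a ρ (Ψ μ) x)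

theorem fourF_zero (d : ℕ) (x : Fin d → ℝ) : fourF d 0 x = 1 := by
  simp [fourF]

theorem fourF_add (d : ℕ) (α β : Fin d → ℤ) (x : Fin d → ℝ) :
    fourF d (α + β) x = fourF d α x * fourF d β x := by
  simp only [fourF, ← Complex.exp_add, ← mul_add, ← Finset.sum_add_distrib, Pi.add_apply,
    Int.cast_add, add_mul]

theorem conj_fourF (d : ℕ) (α : Fin d → ℤ) (x : Fin d → ℝ) :
    (starRingEnd ℂ) (fourF d α x) = fourF d (-α) x := by
  simp [fourF, ← Complex.exp_conj, Complex.conj_ofReal, Complex.conj_ofNat]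

theorem continuous_fourF (d : ℕ) (α : Fin d → ℤ) : Continuous (fourF d α) := by
  unfold fourF
  fun_prop

theorem hasFDerivAt_fourF (d : ℕ) (α : Fin d → ℤ) (x : Fin d → ℝ) :
    HasFDerivAt (fourF d α)
      (fourF d α x • (2 * (Real.pi : ℂ) * Complex.I) •
        ∑ j, (α j : ℂ) • Complex.ofRealCLM.comp (ContinuousLinearMap.proj (R := ℝ) j)) x := by
  have h : HasFDerivAt (fun y : Fin d → ℝ => ∑ j, (α j : ℂ) * (y j : ℂ))
      (∑ j, (α j : ℂ) • Complex.ofRealCLM.comp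
        (ContinuousLinearMap.proj (R := ℝ) (φ := fun _ : Fin d => ℝ) j)) x := by
    refine HasFDerivAt.fun_sum fun j _ => ?_
    exact (Complex.ofRealCLM.comp
      (ContinuousLinearMap.proj (R := ℝ) (φ := fun _ : Fin d => ℝ) j)).hasFDerivAt.const_mul _
  exact (h.const_mul _).cexp

theorem pdv_sum_mul_fourF {ι : Type*} (d : ℕ) (k : Fin d) (s : Finset ι) (c : ι → ℂ)
    (α : ι → Fin d → ℤ) :
    pdv d k (fun y => ∑ i ∈ s, c i * fourF d (α i) y) =
      fun x => ∑ i ∈ s, 2 * (Real.pi : ℂ) * Complex.I * (α i k : ℂ) * c i * fourF d (α i) x := by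
  funext x
  have h := HasFDerivAt.fun_sum (u := s)
    fun i _ => (hasFDerivAt_fourF d (α i) x).const_mul (c i)
  rw [pdv, h.fderiv]
  simp only [_root_.sum_apply, _root_.smul_apply, smul_eq_mul,
    ContinuousLinearMap.comp_apply, ContinuousLinearMap.proj_apply, Complex.ofRealCLM_apply,
    Pi.single_apply]
  refine Finset.sum_congr rfl fun i _ => ?_
  simp [apply_ite, Finset.sum_ite_eq']
  ring

theorem pdv_mul_fourF (d : ℕ) (k : Fin d) (c : ℂ) (α : Fin d → ℤ) :
    pdv d k (fun y => c * fourF d α y) =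
      fun x => 2 * (Real.pi : ℂ) * Complex.I * (α k : ℂ) * c * fourF d α x := by
  simpa using pdv_sum_mul_fourF d k (Finset.univ : Finset Unit) (fun _ => c) (fun _ => α)

theorem integral_exp_two_pi_int (n : ℤ) :
    ∫ t in Set.Icc (0 : ℝ) 1, Complex.exp (2 * (Real.pi : ℂ) * Complex.I * ((n : ℂ) * (t : ℂ))) =
      if n = 0 then 1 else 0 := by
  rw [integral_Icc_eq_integral_Ioc, ← intervalIntegral.integral_of_le zero_le_one]
  split_ifs with hn
  · simp [hn]
  · have hc : 2 * (Real.pi : ℂ) * Complex.I * (n : ℂ) ≠ 0 := by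
      simp [hn, Real.pi_ne_zero]
    simp_rw [← mul_assoc]
    rw [integral_exp_mul_complex hc]
    have h1 : Complex.exp (2 * (Real.pi : ℂ) * Complex.I * (n : ℂ)) = 1 := by
      rw [Complex.exp_eq_one_iff]
      exact ⟨n, by ring⟩
    simp [h1]

theorem integral_fourF (d : ℕ) (α : Fin d → ℤ) :
    ∫ x in Set.Icc (0 : Fin d → ℝ) 1, fourF d α x = if α = 0 then 1 else 0 := by
  have hprod : ∀ x : Fin d → ℝ, fourF d α x =
      ∏ j, Complex.exp (2 * (Real.pi : ℂ) * Complex.I * ((α j : ℂ) * (x j : ℂ))) := fun x => by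
    rw [fourF, Finset.mul_sum, Complex.exp_sum]
  simp_rw [hprod]
  rw [← Set.pi_univ_Icc, volume_pi, Measure.restrict_pi_pi]
  simp only [Pi.zero_apply, Pi.one_apply]
  rw [integral_fintype_prod_eq_prod
    (f := fun j (t : ℝ) => Complex.exp (2 * (Real.pi : ℂ) * Complex.I * ((α j : ℂ) * (t : ℂ))))]
  simp_rw [integral_exp_two_pi_int]
  rw [Finset.prod_ite_zero]
  simp [funext_iff]

theorem integral_sum_mul_conj_sum {ι κ : Type*} (d : ℕ) (s : Finset ι) (t : Finset κ)
    (c : ι → ℂ) (e : κ → ℂ) (α : ι → Fin d → ℤ) (β : κ → Fin d → ℤ) :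
    ∫ x in Set.Icc (0 : Fin d → ℝ) 1, (∑ i ∈ s, c i * fourF d (α i) x) *
        (starRingEnd ℂ) (∑ j ∈ t, e j * fourF d (β j) x) =
      ∑ i ∈ s, ∑ j ∈ t, c i * (starRingEnd ℂ) (e j) * (if α i = β j then 1 else 0) := by
  have hint : ∀ (z : ℂ) (γ : Fin d → ℤ),
      IntegrableOn (fun x => z * fourF d γ x) (Set.Icc (0 : Fin d → ℝ) 1) := fun z γ =>
    (continuous_const.mul (continuous_fourF d γ)).continuousOn.integrableOn_compact isCompact_Icc
  have hexp : ∀ x, (∑ i ∈ s, c i * fourF d (α i) x) *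
      (starRingEnd ℂ) (∑ j ∈ t, e j * fourF d (β j) x) =
      ∑ i ∈ s, ∑ j ∈ t, c i * (starRingEnd ℂ) (e j) * fourF d (α i + -β j) x := fun x => by
    simp only [map_sum, map_mul, conj_fourF, Finset.sum_mul_sum, fourF_add]
    exact Finset.sum_congr rfl fun i _ => Finset.sum_congr rfl fun j _ => by ring
  simp_rw [hexp]
  rw [integral_finsetSum _ fun i _ => integrable_finsetSum _ fun j _ => hint _ _]
  refine Finset.sum_congr rfl fun i _ => ?_
  rw [integral_finsetSum _ fun j _ => hint _ _]
  refine Finset.sum_congr rfl fun j _ => ?_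
  rw [integral_const_mul, integral_fourF]
  simp only [← sub_eq_add_neg, sub_eq_zero]

/-- The operator applied to a multiple of a Fourier function is again a trigonometric polynomial;
the index `none` carries the zeroth-order term. -/
theorem Lop_trigPoly_mul_fourF (d : ℕ) (S : Finset (Fin d → ℤ)) (A : (Fin d → ℤ) → ℂ) (ρ : ℝ)
    (c : ℂ) (ν : Fin d → ℤ) (x : Fin d → ℝ) :
    Lop d (fun y => ∑ τ ∈ S, A τ * fourF d τ y) ρ (fun y => c * fourF d ν y) x =
      ∑ o ∈ Finset.insertNone S,
        c * o.elim (ρ : ℂ)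
          (fun τ => 4 * (Real.pi : ℂ) ^ 2 * ((dotZR d τ ν + enorm2Z d ν : ℝ) : ℂ) * A τ) *
          fourF d (o.elim ν (· + ν)) x := by
  have hflux : ∀ k, (fun y => (∑ τ ∈ S, A τ * fourF d τ y) * pdv d k (fun y => c * fourF d ν y) y) =
      fun y => ∑ τ ∈ S, (2 * (Real.pi : ℂ) * Complex.I * (ν k : ℂ) * c * A τ) *
        fourF d (τ + ν) y := fun k => by
    funext y
    rw [pdv_mul_fourF, Finset.sum_mul]
    refine Finset.sum_congr rfl fun τ _ => ?_
    rw [fourF_add]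
    ring
  simp only [Lop, hflux, pdv_sum_mul_fourF, Finset.sum_insertNone, Option.elim]
  rw [Finset.sum_comm, add_comm, ← Finset.sum_neg_distrib]
  congr 1
  · ring
  refine Finset.sum_congr rfl fun τ _ => ?_
  rw [← Finset.sum_mul, ← neg_mul]
  congr 1
  simp only [dotZR, enorm2Z, ← Finset.sum_add_distrib]
  push_cast
  simp only [Finset.mul_sum, Finset.sum_mul, ← Finset.sum_neg_distrib]
  refine Finset.sum_congr rfl fun k _ => ?_
  simp only [Pi.add_apply]
  push_cast
  linear_combination (-4 * (Real.pi : ℂ) ^ 2 * (τ k + ν k) * ν k * c * A τ) * Complex.I_sq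

theorem GramM_trigPoly (d : ℕ) (S : Finset (Fin d → ℤ)) (A : (Fin d → ℤ) → ℂ) (ρ : ℝ)
    (r : (Fin d → ℤ) → ℝ) (ν μ : Fin d → ℤ) :
    GramM d (fun y => ∑ τ ∈ S, A τ * fourF d τ y) ρ (fun ν x => (r ν : ℂ) * fourF d ν x) ν μ =
      (r ν : ℂ) * (r μ : ℂ) *
        (16 * (Real.pi : ℂ) ^ 4 *
            (∑ τ ∈ S, ∑ τ' ∈ S,
              ((dotZR d τ ν + enorm2Z d ν : ℝ) : ℂ) * ((dotZR d τ' μ + enorm2Z d μ : ℝ) : ℂ) *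
                A τ * (starRingEnd ℂ) (A τ') * (if τ + ν = τ' + μ then 1 else 0))
          + (ρ : ℂ) ^ 2 * (if ν = μ then 1 else 0)
          + 4 * (Real.pi : ℂ) ^ 2 * (ρ : ℂ) *
            (∑ τ ∈ S,
              ((dotZR d τ ν + enorm2Z d ν : ℝ) : ℂ) * A τ * (if τ + ν = μ then 1 else 0))
          + 4 * (Real.pi : ℂ) ^ 2 * (ρ : ℂ) *
            (∑ τ' ∈ S,
              ((dotZR d τ' μ + enorm2Z d μ : ℝ) : ℂ) * (starRingEnd ℂ) (A τ') *
                (if ν = τ' + μ then 1 else 0))) := by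
  simp only [GramM, Lop_trigPoly_mul_fourF]
  rw [integral_sum_mul_conj_sum]
  simp only [Finset.sum_insertNone, Option.elim, map_mul, map_pow, map_ofNat, Complex.conj_ofReal,
    Finset.sum_add_distrib, mul_add, Finset.mul_sum, ← mul_assoc]
  have reorder : ∀ {p q u v p' q' u' v' : ℂ}, p = p' → q = q' → u = u' → v = v' →
      p + v + (q + u) = u' + p' + v' + q' := by
    rintro p q u v _ _ _ _ rfl rfl rfl rfl
    ring
  refine reorder ?_ (Finset.sum_congr rfl fun τ _ => ?_)
    (Finset.sum_congr rfl fun τ _ => Finset.sum_congr rfl fun τ' _ => ?_)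
    (Finset.sum_congr rfl fun τ _ => ?_)
  all_goals congr 1; ring

theorem stmt2 (d : ℕ) (hd : 1 ≤ d)
    (T : Finset (Fin d → ℤ)) (hT0 : (0 : Fin d → ℤ) ∉ T) (hTsym : ∀ τ ∈ T, -τ ∈ T)
    (a₀ ρ : ℝ) (ha₀ : 0 < a₀) (hρ : 0 < ρ)
    (aC : (Fin d → ℤ) → ℂ) (haSym : ∀ τ ∈ T, aC (-τ) = (starRingEnd ℂ) (aC τ))
    (a : (Fin d → ℝ) → ℂ) (ha : a = fun x => (a₀ : ℂ) + ∑ τ ∈ T, aC τ * fourF d τ x)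
    (r : (Fin d → ℤ) → ℝ)
    (hr : r = fun ν => 1 / (4 * Real.pi ^ 2 * enorm2Z d ν + ρ / a₀))
    (Ψ : (Fin d → ℤ) → (Fin d → ℝ) → ℂ)
    (hΨ : Ψ = fun ν x => (r ν : ℂ) * fourF d ν x)
    (A : (Fin d → ℤ) → ℂ) (hA : A = fun τ => if τ = 0 then (a₀ : ℂ) else aC τ) :
    (∀ ν μ : Fin d → ℤ, ν ≠ 0 → μ ≠ 0 →
      GramM d a ρ Ψ ν μ = (r ν : ℂ) * (r μ : ℂ) *
        (16 * (Real.pi : ℂ) ^ 4 *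
            (∑ τ ∈ insert 0 T, ∑ τ' ∈ insert 0 T,
              ((dotZR d τ ν + enorm2Z d ν : ℝ) : ℂ) * ((dotZR d τ' μ + enorm2Z d μ : ℝ) : ℂ) *
                A τ * (starRingEnd ℂ) (A τ') * (if τ + ν = τ' + μ then 1 else 0))
          + (ρ : ℂ) ^ 2 * (if ν = μ then 1 else 0)
          + 4 * (Real.pi : ℂ) ^ 2 * (ρ : ℂ) *
            (∑ τ ∈ insert 0 T,
              ((dotZR d τ ν + enorm2Z d ν : ℝ) : ℂ) * A τ * (if τ + ν = μ then 1 else 0))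
          + 4 * (Real.pi : ℂ) ^ 2 * (ρ : ℂ) *
            (∑ τ' ∈ insert 0 T,
              ((dotZR d τ' μ + enorm2Z d μ : ℝ) : ℂ) * (starRingEnd ℂ) (A τ') *
                (if ν = τ' + μ then 1 else 0)))) ∧
    GramM d a ρ Ψ 0 0 = (((r 0) ^ 2 * ρ ^ 2 : ℝ) : ℂ) ∧
    (∀ ν : Fin d → ℤ, ν ≠ 0 → GramM d a ρ Ψ ν 0 = 0 ∧ GramM d a ρ Ψ 0 ν = 0) := by
  have ha' : a = fun y => ∑ τ ∈ insert 0 T, A τ * fourF d τ y := by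
    subst ha hA
    funext y
    rw [Finset.sum_insert hT0, fourF_zero, mul_one]
    simp only [if_true]
    congr 1
    refine Finset.sum_congr rfl fun τ hτ => ?_
    rw [if_neg (ne_of_mem_of_not_mem hτ hT0)]
  have hG := GramM_trigPoly d (insert 0 T) A ρ r
  rw [← ha', ← hΨ] at hG
  have hzero : ∀ τ : Fin d → ℤ, dotZR d τ 0 + enorm2Z d 0 = 0 := fun τ => by
    simp [dotZR, enorm2Z]
  have hneg : ∀ τ ν : Fin d → ℤ, τ + ν = 0 → dotZR d τ ν + enorm2Z d ν = 0 := fun τ ν h => by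
    obtain rfl := eq_neg_of_add_eq_zero_left h
    simp [dotZR, enorm2Z, sq]
  refine ⟨fun ν μ _ _ => hG ν μ, ?_, fun ν hν => ⟨?_, ?_⟩⟩
  · rw [hG]
    simp only [hzero]
    simp
    ring_nf
    simp
  · rw [hG]
    have hsum : ∑ τ ∈ insert 0 T, ((dotZR d τ ν + enorm2Z d ν : ℝ) : ℂ) * A τ *
        (if τ + ν = 0 then 1 else 0) = 0 := Finset.sum_eq_zero fun τ _ => by
      split_ifs with h
      · simp only [hneg τ ν h, Complex.ofReal_zero, zero_mul]
      · exact mul_zero _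
    rw [hsum]
    simp only [hzero]
    simp [hν]
  · rw [hG]
    have hsum : ∑ τ ∈ insert 0 T, ((dotZR d τ ν + enorm2Z d ν : ℝ) : ℂ) *
        (starRingEnd ℂ) (A τ) * (if 0 = τ + ν then 1 else 0) = 0 :=
      Finset.sum_eq_zero fun τ _ => by
      split_ifs with h
      · simp only [hneg τ ν h.symm, Complex.ofReal_zero, zero_mul]
      · exact mul_zero _
    rw [hsum]
    simp only [hzero]
    simp [hν.symm]
end

section
/- For all integers d ≥ 1 and n ≥ 1, the hyperbolic cross Λ^{HC}_{d,n} = {ν ∈ ℤ^d : Π_{k=1}^d (|ν_k| + 1) ≤ n} is a finite set and its cardinality satisfies |Λ^{HC}_{d,n}| ≤ min{ 4 n⁵ 16^d, e² n^{2 + log₂ d} }. -/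
open Finset

/-- A symmetric sum over `[-N, N]` of a weight dominated by `c / (j + 1) ^ 2` away from zero is at
most `1 + 2 * c`, with an explicit telescoping gain. -/
theorem sum_Icc_neg_self_le {w : ℕ → ℝ} {c : ℝ} (hc : 0 ≤ c) (h0 : w 0 ≤ 1)
    (hw : ∀ j, 1 ≤ j → w j ≤ c / ((j : ℝ) + 1) ^ 2) (N : ℕ) :
    ∑ m ∈ Icc (-(N : ℤ)) N, w m.natAbs ≤ 1 + 2 * c * (1 - 1 / ((N : ℝ) + 1)) := by
  induction N with
  | zero => simpa using h0
  | succ N ih =>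
    have hI : Icc (-((N + 1 : ℕ) : ℤ)) ((N + 1 : ℕ) : ℤ) =
        insert (-((N : ℤ) + 1)) (insert ((N : ℤ) + 1) (Icc (-(N : ℤ)) N)) := by
      ext x
      simp only [mem_Icc, mem_insert]
      omega
    rw [hI, sum_insert (by simp only [mem_insert, mem_Icc]; omega),
      sum_insert (by simp only [mem_Icc]; omega),
      show (-((N : ℤ) + 1)).natAbs = N + 1 by omega, show ((N : ℤ) + 1).natAbs = N + 1 by omega]
    have h1 := hw (N + 1) (by omega)
    have h2 : c / (((N + 1 : ℕ) : ℝ) + 1) ^ 2 ≤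
        c * (1 / ((N : ℝ) + 1) - 1 / (((N + 1 : ℕ) : ℝ) + 1)) := by
      rw [div_eq_mul_one_div]
      refine mul_le_mul_of_nonneg_left ?_ hc
      push_cast
      rw [div_sub_div _ _ (by positivity) (by positivity),
        div_le_div_iff₀ (by positivity) (by positivity)]
      have : (0 : ℝ) ≤ N := N.cast_nonneg
      nlinarith
    linarith

theorem hyperbolicCross_subset (d n : ℕ) :
    {ν : Fin d → ℤ | (∏ k, (|ν k| + 1)) ≤ (n : ℤ)} ⊆
      (Fintype.piFinset fun _ : Fin d => Icc (-(n : ℤ)) n : Finset (Fin d → ℤ)) := by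
  intro ν hν
  simp only [Set.mem_ofPred_eq] at hν
  simp only [mem_coe, Fintype.mem_piFinset, mem_Icc, ← abs_le]
  intro k
  have : |ν k| + 1 ≤ ∏ k, (|ν k| + 1) :=
    Int.le_of_dvd (prod_pos fun i _ => by positivity)
      (dvd_prod_of_mem (fun k => |ν k| + 1) (mem_univ k))
  omega

/-- Rankin's bound for the cardinality of the hyperbolic cross. -/
theorem card_hyperbolicCross_le (d n : ℕ) {s c : ℝ} (hs : 0 ≤ s) (hc : 0 ≤ c)
    (hsc : ∀ j : ℕ, 1 ≤ j → ((j : ℝ) + 1) ^ (-s) ≤ c / ((j : ℝ) + 1) ^ 2) :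
    (Nat.card {ν : Fin d → ℤ | (∏ k, (|ν k| + 1)) ≤ (n : ℤ)} : ℝ) ≤
      (n : ℝ) ^ s * (1 + 2 * c) ^ d := by
  classical
  set w : ℕ → ℝ := fun j => ((j : ℝ) + 1) ^ (-s) with hwdef
  set P : Finset (Fin d → ℤ) := Fintype.piFinset fun _ => Icc (-(n : ℤ)) n
  have hwpos : ∀ j, 0 ≤ w j := fun j => by positivity
  have hset : {ν : Fin d → ℤ | (∏ k, (|ν k| + 1)) ≤ (n : ℤ)} =
      (P.filter fun ν => (∏ k, (|ν k| + 1)) ≤ (n : ℤ) : Finset (Fin d → ℤ)) := by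
    ext ν
    rw [coe_filter]
    exact ⟨fun h => ⟨hyperbolicCross_subset d n h, h⟩, fun h => h.2⟩
  rw [hset, Nat.card_coe_set_eq, Set.ncard_coe_finset]
  have hterm : ∀ ν ∈ P.filter fun ν => (∏ k, (|ν k| + 1)) ≤ (n : ℤ),
      (1 : ℝ) ≤ (n : ℝ) ^ s * ∏ k, w (ν k).natAbs := by
    intro ν hν
    have hle : (∏ k, (((ν k).natAbs : ℝ) + 1)) ≤ n := by
      have := (mem_filter.1 hν).2
      simp only [Int.abs_eq_natAbs] at this
      exact_mod_cast this
    have hpos : (0 : ℝ) < ∏ k, (((ν k).natAbs : ℝ) + 1) := prod_pos fun _ _ => by positivity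
    rw [hwdef, Real.finsetProd_rpow _ _ (fun _ _ => by positivity), Real.rpow_neg hpos.le,
      ← div_eq_mul_inv, one_le_div (by positivity)]
    exact Real.rpow_le_rpow hpos.le hle hs
  calc ((P.filter fun ν => (∏ k, (|ν k| + 1)) ≤ (n : ℤ)).card : ℝ)
      = ∑ ν ∈ P.filter fun ν => (∏ k, (|ν k| + 1)) ≤ (n : ℤ), (1 : ℝ) := by simp
    _ ≤ ∑ ν ∈ P.filter fun ν => (∏ k, (|ν k| + 1)) ≤ (n : ℤ),
          (n : ℝ) ^ s * ∏ k, w (ν k).natAbs := sum_le_sum hterm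
    _ ≤ ∑ ν ∈ P, (n : ℝ) ^ s * ∏ k, w (ν k).natAbs :=
        sum_le_sum_of_subset_of_nonneg (filter_subset _ _) fun ν _ _ =>
          mul_nonneg (by positivity) (prod_nonneg fun k _ => hwpos _)
    _ = (n : ℝ) ^ s * (∑ m ∈ Icc (-(n : ℤ)) n, w m.natAbs) ^ d := by
        rw [← mul_sum, ← prod_univ_sum (fun _ : Fin d => Icc (-(n : ℤ)) n)
          (fun _ m => w m.natAbs), prod_const, card_univ, Fintype.card_fin]
    _ ≤ (n : ℝ) ^ s * (1 + 2 * c) ^ d := by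
        refine mul_le_mul_of_nonneg_left (pow_le_pow_left₀ (sum_nonneg fun _ _ => hwpos _) ?_ d)
          (by positivity)
        refine (sum_Icc_neg_self_le hc (by simp) hsc n).trans ?_
        have : 0 ≤ 2 * c * (1 / ((n : ℝ) + 1)) := by positivity
        linarith

theorem stmt11 (d n : ℕ) (hd : 1 ≤ d) (hn : 1 ≤ n) :
    {ν : Fin d → ℤ | (∏ k, (|ν k| + 1)) ≤ (n : ℤ)}.Finite ∧
    (Nat.card {ν : Fin d → ℤ | (∏ k, (|ν k| + 1)) ≤ (n : ℤ)} : ℝ) ≤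
      min (4 * (n : ℝ) ^ 5 * 16 ^ d)
        (Real.exp 1 ^ 2 * (n : ℝ) ^ ((2 : ℝ) + Real.logb 2 d)) := by
  refine ⟨(finite_toSet _).subset (hyperbolicCross_subset d n), le_min ?_ ?_⟩
  · have hn' : (1 : ℝ) ≤ n := by exact_mod_cast hn
    refine (card_hyperbolicCross_le d n (s := 2) (c := 1) (by norm_num) (by norm_num)
      fun j _ => ?_).trans ?_
    · rw [Real.rpow_neg (by positivity), Real.rpow_two, one_div]
    · rw [Real.rpow_two]
      have h1 : (n : ℝ) ^ 2 ≤ (n : ℝ) ^ 5 := pow_le_pow_right₀ hn' (by norm_num)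
      have h2 : (n : ℝ) ^ 5 ≤ 4 * (n : ℝ) ^ 5 := by
        linarith [pow_nonneg (by linarith : (0 : ℝ) ≤ n) 5]
      gcongr
      · exact h1.trans h2
      · norm_num
  · have hd' : (1 : ℝ) ≤ d := by exact_mod_cast hd
    have hd0 : (0 : ℝ) < d := by linarith
    have hlog : 0 ≤ Real.logb 2 d := Real.logb_nonneg (by norm_num) hd'
    refine (card_hyperbolicCross_le d n (s := 2 + Real.logb 2 d) (c := 1 / d) (by linarith)
      (by positivity) fun j hj => ?_).trans ?_
    · have hj' : (1 : ℝ) ≤ j := by exact_mod_cast hj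
      have hpow : (d : ℝ) ≤ ((j : ℝ) + 1) ^ Real.logb 2 d :=
        calc (d : ℝ) = 2 ^ Real.logb 2 d :=
              (Real.rpow_logb (by norm_num) (by norm_num) hd0).symm
          _ ≤ ((j : ℝ) + 1) ^ Real.logb 2 d :=
              Real.rpow_le_rpow (by norm_num) (by linarith) hlog
      rw [Real.rpow_neg (by positivity), Real.rpow_add (by positivity), Real.rpow_two, div_div,
        ← one_div, mul_comm]
      gcongr
    · rw [mul_comm]
      gcongr
      calc (1 + 2 * (1 / (d : ℝ))) ^ d ≤ Real.exp (2 * (1 / (d : ℝ))) ^ d := by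
            gcongr
            linarith [Real.add_one_le_exp (2 * (1 / (d : ℝ)))]
        _ = Real.exp 1 ^ 2 := by
            rw [← Real.exp_nat_mul, ← Real.exp_nat_mul]
            congr 1
            field_simp
            norm_num
end
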